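/- arXiv:cs/0312057 — 2 statements merged into one kernel-verified Lean document; each statement's English description precedes it below -/
import Mathlib

section
/- For any ground extended program P, the operator ω^P_ext on three-valued interpretations of P is monotone with respect to the information ordering of interpretations; consequently it has a least fixed point WFS(P) in the information ordering. -/
namespace Abdual


/-- Objective literals over a set of atoms `α`: an atom or its explicit negation. -/
inductive ObjLit (α : Type) : Type
  | pos : α → ObjLit α
  | neg : α → ObjLit α

/-- Literals: an objective literal, its default negation, or one of the truth
constants `t`, `f`, `u`. -/
inductive Lit (α : Type) : Type
  | obj : ObjLit α → Lit α
  | not : ObjLit α → Lit α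
  | tru : Lit α
  | fls : Lit α
  | und : Lit α

/-- The explicit conjugate of an objective literal. -/
def ObjLit.conjE {α : Type} : ObjLit α → ObjLit α
  | .pos a => .neg a
  | .neg a => .pos a

/-- The default conjugate of a literal. -/
def Lit.conjD {α : Type} : Lit α → Lit α
  | .obj o => .not o
  | .not o => .obj o
  | .tru => .fls
  | .fls => .tru
  | .und => .und

/-- A literal is positive if it is an objective literal. -/
def Lit.IsPositive {α : Type} (L : Lit α) : Prop := ∃ o : ObjLit α, L = Lit.obj o

/-- A literal is negative if it is the default negation of an objective literal. -/
def Lit.IsNegative {α : Type} (L : Lit α) : Prop := ∃ o : ObjLit α, L = Lit.not o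

/-- The objective literal underlying a literal, if any. -/
def Lit.objOf {α : Type} : Lit α → Option (ObjLit α)
  | .obj o => some o
  | .not o => some o
  | _ => none

/-- A ground rule `head ← body`. -/
structure Rule (α : Type) where
  head : Lit α
  body : List (Lit α)

/-- A ground program: a set of ground rules. -/
abbrev Program (α : Type) := Set (Rule α)

/-- An extended program: every rule head is an objective literal. -/
def Program.Extended {α : Type} (P : Program α) : Prop :=
  ∀ r ∈ P, ∃ o : ObjLit α, r.head = Lit.obj o

/-- The objective literals occurring (in the head or body of a rule) in `P`. -/
def Program.objOccurs {α : Type} (P : Program α) : Set (ObjLit α) :=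
  {O | ∃ r ∈ P, Lit.objOf r.head = some O ∨ ∃ L ∈ r.body, Lit.objOf L = some O}

/-- `objective_literals(P)`: the objective literals occurring in `P`, closed under
explicit conjugation. -/
def Program.objectiveLiterals {α : Type} (P : Program α) : Set (ObjLit α) :=
  Program.objOccurs P ∪ ObjLit.conjE '' Program.objOccurs P

/-- `literals(P)`: the literals occurring in `P`, closed under explicit and default
conjugation. -/
def Program.literals {α : Type} (P : Program α) : Set (Lit α) :=
  {L | ∃ O ∈ Program.objectiveLiterals P, L = Lit.obj O ∨ L = Lit.not O}

/-- A three-valued interpretation: a set of literals. -/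
abbrev Interp (α : Type) := Set (Lit α)

/-- The set of objective literals true in an interpretation. -/
def Interp.T {α : Type} (I : Interp α) : Set (ObjLit α) := {O | Lit.obj O ∈ I}

/-- The set of objective literals false in an interpretation. -/
def Interp.F {α : Type} (I : Interp α) : Set (ObjLit α) := {O | Lit.not O ∈ I}

/-- The information ordering on interpretations. -/
def Interp.InfoLE {α : Type} (I J : Interp α) : Prop :=
  Interp.T I ⊆ Interp.T J ∧ Interp.F I ⊆ Interp.F J

/-- Consistent interpretation: no objective literal is both true and false. -/
def Interp.Consistent {α : Type} (I : Interp α) : Prop :=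
  ∀ O : ObjLit α, ¬ (Lit.obj O ∈ I ∧ Lit.not O ∈ I)

/-- Satisfaction of a literal in an interpretation, with the convention that `t`
(and `not f`) belong to every model while neither `u` nor `f` (nor `not u`)
belong to any model. -/
def Lit.sat {α : Type} (I : Interp α) : Lit α → Prop
  | .obj o => Lit.obj o ∈ I
  | .not o => Lit.not o ∈ I
  | .tru => True
  | .fls => False
  | .und => False

/-- The operator `Tx^P_I` on sets of ground objective literals. -/
def Tx {α : Type} (P : Program α) (I : Interp α) (O1 : Set (ObjLit α)) :
    Set (ObjLit α) :=
  {O | ∃ r ∈ P, r.head = Lit.obj O ∧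
        ∀ L ∈ r.body, Lit.sat I L ∨ ∃ o : ObjLit α, L = Lit.obj o ∧ o ∈ O1}

/-- The operator `Fx^P_I` on sets of ground objective literals. -/
def Fx {α : Type} (P : Program α) (I : Interp α) (O2 : Set (ObjLit α)) :
    Set (ObjLit α) :=
  {O | Lit.sat I (Lit.obj (ObjLit.conjE O)) ∨
        ∀ r ∈ P, r.head = Lit.obj O →
          ∃ L ∈ r.body, Lit.sat I (Lit.conjD L) ∨ ∃ o : ObjLit α, L = Lit.obj o ∧ o ∈ O2}

/-- `lfp(Tx^P_I)`, iterating up from `∅` (Knaster–Tarski form). -/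
def lfpTx {α : Type} (P : Program α) (I : Interp α) : Set (ObjLit α) :=
  sInf {S | Tx P I S ⊆ S}

/-- `gfp(Fx^P_I)`, iterating down from `objective_literals(P)` (Knaster–Tarski form). -/
def gfpFx {α : Type} (P : Program α) (I : Interp α) : Set (ObjLit α) :=
  sSup {S | S ⊆ Program.objectiveLiterals P ∧ S ⊆ Fx P I S}

/-- The operator `ω^P_ext` on interpretations. -/
def omegaExt {α : Type} (P : Program α) (I : Interp α) : Interp α :=
  (Lit.obj '' lfpTx P I) ∪ (Lit.not '' gfpFx P I)

/-- `WFS(P)`: the least fixed point, in the information ordering, of `ω^P_ext`. -/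
def WFS {α : Type} (P : Program α) : Interp α :=
  sInf {I : Interp α | omegaExt P I ⊆ I}

/-- Consistency of a set of (abducible) objective literals: it contains no
objective literal together with its explicit conjugate. -/
def CtxConsistent {α : Type} (C : Set (ObjLit α)) : Prop :=
  ∀ O ∈ C, ObjLit.conjE O ∉ C

/-- An abductive framework `⟨P, A, I⟩` with a designated falsum atom `⊥`. -/
structure Framework (α : Type) where
  prog : Program α
  abducibles : Set (ObjLit α)
  constraints : Program α
  falsum : α
  prog_extended : Program.Extended prog
  abd_finite : abducibles.Finite
  abd_conj_closed : ∀ O ∈ abducibles, ObjLit.conjE O ∈ abducibles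
  no_abducible_head : ∀ r ∈ prog, ∀ O ∈ abducibles, r.head ≠ Lit.obj O
  constraints_head : ∀ r ∈ constraints, r.head = Lit.obj (ObjLit.pos falsum)
  falsum_fresh : ObjLit.pos falsum ∉ Program.objOccurs prog

/-- `P_B`: the program of hypotheses of a scenario with abducibles `A` and
abduced set `B` (`O ← t` for `O ∈ B`, `O ← u` for the remaining abducibles). -/
def hypProgram {α : Type} (A B : Set (ObjLit α)) : Program α :=
  {r | (∃ O ∈ B, r = Rule.mk (Lit.obj O) [Lit.tru]) ∨
       (∃ O ∈ A, O ∉ B ∧ r = Rule.mk (Lit.obj O) [Lit.und])}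

/-- `B` determines a scenario of the framework. -/
def Framework.IsScenario {α : Type} (fw : Framework α) (B : Set (ObjLit α)) : Prop :=
  B ⊆ fw.abducibles ∧ CtxConsistent B

/-- The program `P ∪ P_B ∪ I` of a scenario. -/
def Framework.scenarioProgram {α : Type} (fw : Framework α) (B : Set (ObjLit α)) :
    Program α :=
  fw.prog ∪ hypProgram fw.abducibles B ∪ fw.constraints

/-- `M(σ) = WFS(P ∪ P_B ∪ I)`. -/
def Framework.M {α : Type} (fw : Framework α) (B : Set (ObjLit α)) : Interp α :=
  WFS (Framework.scenarioProgram fw B)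

/-- An abductive solution: a scenario in which `⊥` is false. -/
def Framework.IsSolution {α : Type} (fw : Framework α) (B : Set (ObjLit α)) : Prop :=
  Framework.IsScenario fw B ∧ Lit.not (ObjLit.pos fw.falsum) ∈ Framework.M fw B

/-- An abductive solution for a query `Q`. -/
def Framework.IsSolutionFor {α : Type} (fw : Framework α) (B : Set (ObjLit α))
    (Q : Lit α) : Prop :=
  Framework.IsSolution fw B ∧ Lit.sat (Framework.M fw B) Q

/-- A minimal abductive solution for a query `Q`. -/
def Framework.IsMinimalSolutionFor {α : Type} (fw : Framework α) (B : Set (ObjLit α))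
    (Q : Lit α) : Prop :=
  Framework.IsSolutionFor fw B Q ∧
  ∀ B' : Set (ObjLit α), Framework.IsSolutionFor fw B' Q →
    Interp.InfoLE (WFS (hypProgram fw.abducibles B')) (WFS (hypProgram fw.abducibles B)) →
    B' = B


theorem sat_mono {α : Type} {I J : Interp α} (h : Interp.InfoLE I J) (L : Lit α)
    (hL : Lit.sat I L) : Lit.sat J L := by
  cases L with
  | obj o => exact h.1 hL
  | not o => exact h.2 hL
  | tru => trivial
  | fls => exact hL
  | und => exact hL

theorem Tx_mono {α : Type} (P : Program α) {I J : Interp α} (h : Interp.InfoLE I J)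
    (S : Set (ObjLit α)) : Tx P I S ⊆ Tx P J S := by
  rintro O ⟨r, hr, hh, hb⟩
  exact ⟨r, hr, hh, fun L hL => (hb L hL).imp (sat_mono h L) id⟩

theorem Fx_mono {α : Type} (P : Program α) {I J : Interp α} (h : Interp.InfoLE I J)
    (S : Set (ObjLit α)) : Fx P I S ⊆ Fx P J S := by
  rintro O (hO | hO)
  · exact Or.inl (sat_mono h _ hO)
  · refine Or.inr fun r hr hh => ?_
    obtain ⟨L, hL, h1⟩ := hO r hr hh
    exact ⟨L, hL, h1.imp (sat_mono h _) id⟩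

theorem lfpTx_mono {α : Type} (P : Program α) {I J : Interp α} (h : Interp.InfoLE I J) :
    lfpTx P I ⊆ lfpTx P J :=
  sInf_le_sInf fun S hS => (Tx_mono P h S).trans hS

theorem gfpFx_mono {α : Type} (P : Program α) {I J : Interp α} (h : Interp.InfoLE I J) :
    gfpFx P I ⊆ gfpFx P J :=
  sSup_le_sSup fun S hS => ⟨hS.1, hS.2.trans (Fx_mono P h S)⟩

theorem InfoLE_of_subset {α : Type} {I J : Interp α} (h : I ⊆ J) : Interp.InfoLE I J :=
  ⟨fun _ hO => h hO, fun _ hO => h hO⟩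

theorem omegaExt_mono {α : Type} (P : Program α) {I J : Interp α} (h : Interp.InfoLE I J) :
    omegaExt P I ⊆ omegaExt P J :=
  Set.union_subset_union (Set.image_mono (lfpTx_mono P h)) (Set.image_mono (gfpFx_mono P h))

/-- For any ground extended program `P`, the operator `ω^P_ext` is
monotone with respect to the information ordering of interpretations;
consequently it has a least fixed point `WFS(P)` in the information ordering. -/
theorem omegaExt_monotone_and_lfp {α : Type} (P : Program α) (hcnt : P.Countable)
    (hext : Program.Extended P) :
    (∀ I J : Interp α, I ⊆ Program.literals P → J ⊆ Program.literals P →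
        Interp.InfoLE I J → Interp.InfoLE (omegaExt P I) (omegaExt P J)) ∧
    (omegaExt P (WFS P) = WFS P ∧
      ∀ W : Interp α, omegaExt P W = W → Interp.InfoLE (WFS P) W) := by
  have hle : omegaExt P (WFS P) ⊆ WFS P := by
    apply le_sInf
    intro I hI
    exact (omegaExt_mono P (InfoLE_of_subset (sInf_le hI))).trans hI
  refine ⟨fun I J _ _ h => InfoLE_of_subset (omegaExt_mono P h), ?_, ?_⟩
  · exact Set.Subset.antisymm hle (sInf_le (omegaExt_mono P (InfoLE_of_subset hle)))
  · intro W hW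
    exact InfoLE_of_subset (sInf_le hW.subset)

end Abdual
end

section
/- Let P be a ground extended program and let dual(P,∅) be the dual program formed by applying the dual transformation to P with an empty set of abducibles. Then for every literal L ∈ literals(P): L ∈ WFS(P) if and only if L ∈ lfp(ω_d^{dual(P,∅)}), where the least fixed point is taken with respect to the information ordering of interpretations. -/
namespace Abdual


/-! ### The dual transformation -/

/-- Atoms of the dual program: base atoms plus fresh folding atoms
`fold^a_i_O` and `fold^b_i_O`. -/
inductive DAtom (α : Type) : Type
  | base : α → DAtom α
  | foldA : ObjLit α → ℕ → DAtom α
  | foldB : ObjLit α → ℕ → DAtom α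

/-- Lift an objective literal to the dual alphabet. -/
def ObjLit.lift {α : Type} : ObjLit α → ObjLit (DAtom α)
  | .pos a => .pos (.base a)
  | .neg a => .neg (.base a)

/-- Lift a literal to the dual alphabet. -/
def Lit.lift {α : Type} : Lit α → Lit (DAtom α)
  | .obj o => .obj (ObjLit.lift o)
  | .not o => .not (ObjLit.lift o)
  | .tru => .tru
  | .fls => .fls
  | .und => .und

/-- Lift a rule to the dual alphabet. -/
def Rule.lift {α : Type} (r : Rule α) : Rule (DAtom α) :=
  ⟨Lit.lift r.head, r.body.map Lit.lift⟩

/-- Lift a program to the dual alphabet. -/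
def Program.lift {α : Type} (P : Program α) : Program (DAtom α) := Rule.lift '' P

/-- `O` has a fact in `P`. -/
def hasFact {α : Type} (P : Program α) (O : ObjLit α) : Prop :=
  Rule.mk (Lit.obj O) [] ∈ P

/-- `O` is the head of some rule of `P`. -/
def hasRule {α : Type} (P : Program α) (O : ObjLit α) : Prop :=
  ∃ b, Rule.mk (Lit.obj O) b ∈ P

/-- An enumeration (without repetition, with initial-segment domain) of the
rules of `P` for each objective literal head. -/
structure RuleEnum {α : Type} (P : Program α) where
  enum : ObjLit α → ℕ → Option (List (Lit α))
  mem_iff : ∀ O body, Rule.mk (Lit.obj O) body ∈ P ↔ ∃ i, enum O i = some body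
  downward : ∀ O i, enum O i = none → enum O (i + 1) = none
  inj : ∀ O i j b, enum O i = some b → enum O j = some b → i = j

/-- The folding rules of the dual transformation. -/
def foldRules {α : Type} (P : Program α) (e : RuleEnum P) : Program (DAtom α) :=
  {r | ∃ O : ObjLit α, hasRule P O ∧ ¬ hasFact P O ∧
    (r = Rule.mk (Lit.not (ObjLit.lift O)) [Lit.not (ObjLit.pos (DAtom.foldA O 0))] ∨
     (∃ i b b', e.enum O i = some b ∧ e.enum O (i + 1) = some b' ∧
        r = Rule.mk (Lit.not (ObjLit.pos (DAtom.foldA O i)))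
              [Lit.not (ObjLit.pos (DAtom.foldB O i)),
               Lit.not (ObjLit.pos (DAtom.foldA O (i + 1)))]) ∨
     (∃ i b, e.enum O i = some b ∧ e.enum O (i + 1) = none ∧
        r = Rule.mk (Lit.not (ObjLit.pos (DAtom.foldA O i)))
              [Lit.not (ObjLit.pos (DAtom.foldB O i))]) ∨
     (∃ i b L, e.enum O i = some b ∧ L ∈ b ∧
        r = Rule.mk (Lit.not (ObjLit.pos (DAtom.foldB O i))) [Lit.lift (Lit.conjD L)]))}

/-- The rules `not(O) ← t` for objective literals with no defining rule. -/
def noDefRules {α : Type} (P : Program α) : Program (DAtom α) :=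
  {r | ∃ O : ObjLit α, Lit.not O ∈ Program.literals P ∧ ¬ hasRule P O ∧
        r = Rule.mk (Lit.not (ObjLit.lift O)) [Lit.tru]}

/-- The dual program before adding the coherency axioms. -/
def preDual {α : Type} (P : Program α) (e : RuleEnum P) : Program (DAtom α) :=
  Program.lift P ∪ foldRules P e ∪ noDefRules P

/-- The coherency axioms `not(O) ← conj_E(O)`. -/
def coherencyRules {α : Type} (P : Program α) (A : Set (ObjLit α)) (e : RuleEnum P) :
    Program (DAtom α) :=
  {r | ∃ O : ObjLit (DAtom α),
        (Lit.not O ∈ Program.literals (preDual P e) ∨ ∃ O₀ ∈ A, O = ObjLit.lift O₀) ∧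
        r = Rule.mk (Lit.not O) [Lit.obj (ObjLit.conjE O)]}

/-- The dual program `dual(P, A)` (relative to an enumeration of the rules of `P`). -/
def dualProgram {α : Type} (P : Program α) (A : Set (ObjLit α)) (e : RuleEnum P) :
    Program (DAtom α) :=
  preDual P e ∪ coherencyRules P A e

/-- The operator `Td^{dual(P,A)}_I` on sets of ground objective literals. -/
def Td {α : Type} (D : Program α) (I : Interp α) (O1 : Set (ObjLit α)) :
    Set (ObjLit α) :=
  {O | ∃ r ∈ D, r.head = Lit.obj O ∧
        ∀ L ∈ r.body, Lit.sat I L ∨ ∃ o : ObjLit α, L = Lit.obj o ∧ o ∈ O1}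

/-- The operator `Fd^{dual(P,A)}_I` on sets of ground negative literals. -/
def Fd {α : Type} (D : Program α) (I : Interp α) (L1 : Set (Lit α)) : Set (Lit α) :=
  {L | ∃ O : ObjLit α, L = Lit.not O ∧ ∃ r ∈ D, r.head = Lit.not O ∧
        ∀ L' ∈ r.body, Lit.sat I L' ∨ L' ∈ L1}

/-- `lfp(Td^D_I)` (Knaster–Tarski form). -/
def lfpTd {α : Type} (D : Program α) (I : Interp α) : Set (ObjLit α) :=
  sInf {S | Td D I S ⊆ S}

/-- The set of all negative literals of a program. -/
def negLiterals {α : Type} (D : Program α) : Set (Lit α) :=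
  {L | L ∈ Program.literals D ∧ Lit.IsNegative L}

/-- `gfp(Fd^D_I)`, iterating down from the set of all negative literals of `D`
(Knaster–Tarski form). -/
def gfpFd {α : Type} (D : Program α) (I : Interp α) : Set (Lit α) :=
  sSup {S | S ⊆ negLiterals D ∧ S ⊆ Fd D I S}

/-- The operator `ω_d^{dual(P,A)}` on interpretations. -/
def omegaD {α : Type} (D : Program α) (I : Interp α) : Interp α :=
  (Lit.obj '' lfpTd D I) ∪ gfpFd D I

/-- `lfp(ω_d^D)` in the information ordering. -/
def lfpOmegaD {α : Type} (D : Program α) : Interp α :=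
  sInf {I : Interp α | omegaD D I ⊆ I}

/-- The size of a finite ground program: the sum over all rules of 1 plus the
number of body literals. -/
noncomputable def Program.size {α : Type} (P : Program α) : ℕ :=
  ∑ᶠ r ∈ P, (1 + (Rule.body r).length)



theorem ObjLit.lift_inj {α : Type} : ∀ {a b : ObjLit α}, ObjLit.lift a = ObjLit.lift b → a = b
  | .pos _, .pos _, h => by simpa [ObjLit.lift] using h
  | .neg _, .neg _, h => by simpa [ObjLit.lift] using h
  | .pos _, .neg _, h => by simp [ObjLit.lift] at h
  | .neg _, .pos _, h => by simp [ObjLit.lift] at h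

theorem Lit.lift_inj {α : Type} {a b : Lit α} (h : Lit.lift a = Lit.lift b) : a = b := by
  cases a <;> cases b <;> simp [Lit.lift] at h <;> first | rfl | (rw [ObjLit.lift_inj h])

theorem ObjLit.lift_conjE {α : Type} (a : ObjLit α) :
    (ObjLit.lift a).conjE = ObjLit.lift a.conjE := by
  cases a <;> rfl

theorem ObjLit.conjE_conjE {α : Type} (a : ObjLit α) : a.conjE.conjE = a := by
  cases a <;> rfl

theorem sat_lift {α : Type} (I : Interp α) (J : Interp (DAtom α))
    (h : ∀ L, Lit.lift L ∈ J ↔ L ∈ I) (L : Lit α) :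
    Lit.sat J (Lit.lift L) ↔ Lit.sat I L := by
  cases L with
  | obj o => exact h (.obj o)
  | not o => exact h (.not o)
  | tru => exact Iff.rfl
  | fls => exact Iff.rfl
  | und => exact Iff.rfl

theorem mem_objLits_conj {α : Type} {P : Program α} {O : ObjLit α}
    (h : O.conjE ∈ Program.objOccurs P) : O ∈ Program.objectiveLiterals P :=
  Or.inr ⟨_, h, ObjLit.conjE_conjE O⟩

theorem hasRule_mem {α : Type} {P : Program α} {O : ObjLit α} (h : hasRule P O) :
    O ∈ Program.objectiveLiterals P := by
  obtain ⟨b, hb⟩ := h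
  exact Or.inl ⟨_, hb, Or.inl rfl⟩

theorem not_mem_lits {α : Type} {P : Program α} {O : ObjLit α} :
    Lit.not O ∈ Program.literals P ↔ O ∈ Program.objectiveLiterals P := by
  constructor
  · rintro ⟨O', h, h' | h'⟩
    · cases h'
    · cases h'; exact h
  · intro h; exact ⟨O, h, Or.inr rfl⟩

theorem objOf_lift {α : Type} (L : Lit α) :
    Lit.objOf (Lit.lift L) = (Lit.objOf L).map ObjLit.lift := by
  cases L <;> rfl

theorem objOf_conjD {α : Type} (L : Lit α) : Lit.objOf (Lit.conjD L) = Lit.objOf L := by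
  cases L <;> rfl

theorem objOf_lift_eq {α : Type} {L : Lit α} {O : ObjLit α}
    (h : Lit.objOf (Lit.lift L) = some (ObjLit.lift O)) : Lit.objOf L = some O := by
  rw [objOf_lift] at h
  cases hL : Lit.objOf L with
  | none => rw [hL] at h; cases h
  | some o =>
    rw [hL] at h
    simp only [Option.map_some, Option.some.injEq] at h
    rw [ObjLit.lift_inj h]

theorem lift_ne_pos_foldA {α : Type} {O o : ObjLit α} {i : ℕ} :
    ObjLit.pos (DAtom.foldA o i) ≠ ObjLit.lift O := by
  cases O <;> simp [ObjLit.lift]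

theorem lift_ne_pos_foldB {α : Type} {O o : ObjLit α} {i : ℕ} :
    ObjLit.pos (DAtom.foldB o i) ≠ ObjLit.lift O := by
  cases O <;> simp [ObjLit.lift]

theorem occ_preDual {α : Type} {P : Program α} {e : RuleEnum P} {O : ObjLit α}
    (h : ObjLit.lift O ∈ Program.objOccurs (preDual P e)) :
    O ∈ Program.objectiveLiterals P := by
  obtain ⟨r, hr, hO⟩ := h
  rcases hr with (⟨r, hr, rfl⟩ | ⟨o, hR, -, hr⟩) | ⟨o, ho, -, rfl⟩
  · left
    refine ⟨r, hr, ?_⟩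
    rcases hO with hO | ⟨L, hL, hO⟩
    · exact Or.inl (objOf_lift_eq hO)
    · simp only [Rule.lift, List.mem_map] at hL
      obtain ⟨L, hL, rfl⟩ := hL
      exact Or.inr ⟨L, hL, objOf_lift_eq hO⟩
  · rcases hr with rfl | ⟨i, b, b', _, _, rfl⟩ | ⟨i, b, _, _, rfl⟩ | ⟨i, b, L, hb, hL, rfl⟩
    · simp only [Lit.objOf, List.mem_singleton, exists_eq_left, Option.some.injEq] at hO
      rcases hO with hO | hO
      · rw [← ObjLit.lift_inj hO]; exact hasRule_mem hR
      · exact absurd hO lift_ne_pos_foldA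
    · simp only [Lit.objOf, List.mem_cons, List.not_mem_nil, or_false, exists_eq_or_imp,
        exists_eq_left, Option.some.injEq] at hO
      rcases hO with hO | hO | hO
      · exact absurd hO lift_ne_pos_foldA
      · exact absurd hO lift_ne_pos_foldB
      · exact absurd hO lift_ne_pos_foldA
    · simp only [Lit.objOf, List.mem_singleton, exists_eq_left, Option.some.injEq] at hO
      rcases hO with hO | hO
      · exact absurd hO lift_ne_pos_foldA
      · exact absurd hO lift_ne_pos_foldB
    · rcases hO with hO | ⟨L', hL', hO⟩
      · simp only [Lit.objOf, Option.some.injEq] at hO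
        exact absurd hO lift_ne_pos_foldB
      · simp only [List.mem_singleton] at hL'
        subst hL'
        have := objOf_lift_eq hO
        rw [objOf_conjD] at this
        exact Or.inl ⟨_, (e.mem_iff o b).2 ⟨i, hb⟩, Or.inr ⟨L, hL, this⟩⟩
  · rcases hO with hO | ⟨L, hL, hO⟩
    · simp only [Lit.objOf, Option.some.injEq] at hO
      rw [← ObjLit.lift_inj hO]; exact not_mem_lits.1 ho
    · simp only [List.mem_singleton] at hL
      subst hL
      cases hO

theorem conjE_mem_objLits {α : Type} {P : Program α} {O : ObjLit α}
    (h : O.conjE ∈ Program.objectiveLiterals P) : O ∈ Program.objectiveLiterals P := by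
  rcases h with h | ⟨o, ho, h⟩
  · exact mem_objLits_conj h
  · have : o = O := by rw [← ObjLit.conjE_conjE o, h, ObjLit.conjE_conjE]
    exact Or.inl (this ▸ ho)

theorem lits_preDual {α : Type} {P : Program α} {e : RuleEnum P} {O : ObjLit α}
    (h : Lit.not (ObjLit.lift O) ∈ Program.literals (preDual P e)) :
    O ∈ Program.objectiveLiterals P := by
  rcases not_mem_lits.1 h with h | ⟨o, ho, h⟩
  · exact occ_preDual h
  · have : o = ObjLit.lift O.conjE := by
      rw [← ObjLit.lift_conjE, ← h, ObjLit.conjE_conjE]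
    exact conjE_mem_objLits (occ_preDual (this ▸ ho))

theorem occ_lift {α : Type} {P : Program α} {e : RuleEnum P} {O : ObjLit α}
    (h : O ∈ Program.objOccurs P) : ObjLit.lift O ∈ Program.objOccurs (preDual P e) := by
  obtain ⟨r, hr, h⟩ := h
  refine ⟨Rule.lift r, Or.inl (Or.inl ⟨r, hr, rfl⟩), ?_⟩
  rcases h with h | ⟨L, hL, h⟩
  · left; simp [Rule.lift, objOf_lift, h]
  · right
    exact ⟨Lit.lift L, List.mem_map_of_mem hL, by simp [objOf_lift, h]⟩

theorem lits_lift {α : Type} {P : Program α} {e : RuleEnum P} {O : ObjLit α}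
    (h : O ∈ Program.objectiveLiterals P) :
    Lit.not (ObjLit.lift O) ∈ Program.literals (preDual P e) := by
  rw [not_mem_lits]
  rcases h with h | ⟨o, ho, rfl⟩
  · exact Or.inl (occ_lift h)
  · exact Or.inr ⟨_, occ_lift ho, ObjLit.lift_conjE o⟩

theorem subset_gfpFd {α : Type} {D : Program α} {J : Interp α} {S : Set (Lit α)}
    (h : S ⊆ Fd D J S) : S ⊆ gfpFd D J := by
  intro L hL
  refine Set.mem_sUnion.2 ⟨S, ⟨?_, h⟩, hL⟩
  intro L hL
  obtain ⟨O, rfl, r, hr, hh, -⟩ := h hL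
  exact ⟨not_mem_lits.2 (Or.inl ⟨r, hr, Or.inl (by rw [hh]; rfl)⟩), O, rfl⟩

theorem lfpTd_closed {α : Type} (D : Program α) (J : Interp α) :
    Td D J (lfpTd D J) ⊆ lfpTd D J := by
  rintro O ⟨r, hr, hh, hb⟩
  refine Set.mem_sInter.2 fun S hS => hS ⟨r, hr, hh, fun L hL => ?_⟩
  rcases hb L hL with h | ⟨o, h, ho⟩
  · exact Or.inl h
  · exact Or.inr ⟨o, h, Set.mem_sInter.1 ho S hS⟩

theorem lfpTx_closed {α : Type} (D : Program α) (J : Interp α) :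
    Tx D J (lfpTx D J) ⊆ lfpTx D J := lfpTd_closed D J

theorem enum_zero {α : Type} {P : Program α} (e : RuleEnum P) {O : ObjLit α}
    (h : hasRule P O) : ∃ b, e.enum O 0 = some b := by
  obtain ⟨b, hb⟩ := h
  obtain ⟨i, hi⟩ := (e.mem_iff O b).1 hb
  cases h0 : e.enum O 0 with
  | some b => exact ⟨b, rfl⟩
  | none =>
    have : ∀ i, e.enum O i = none := fun i => by
      induction i with
      | zero => exact h0
      | succ k ih => exact e.downward O k ih
    rw [this i] at hi; cases hi

theorem enum_none_ge {α : Type} {P : Program α} (e : RuleEnum P) {O : ObjLit α} {i j : ℕ}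
    (h : e.enum O i = none) (hij : i ≤ j) : e.enum O j = none := by
  induction hij with
  | refl => exact h
  | step _ ih => exact e.downward O _ ih

/-- The pullback of a prefixed point of the dual operator is a prefixed point. -/
theorem forward {α : Type} (P : Program α) (e : RuleEnum P) (J : Interp (DAtom α))
    (hJ : omegaD (dualProgram P ∅ e) J ⊆ J) :
    omegaExt P {L | Lit.lift L ∈ J} ⊆ {L | Lit.lift L ∈ J} := by
  set I : Interp α := {L | Lit.lift L ∈ J} with hI
  have hs := sat_lift I J (fun L => Iff.rfl)
  rintro L (⟨O, hO, rfl⟩ | ⟨O, hO, rfl⟩)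
  · refine hJ (Or.inl ⟨ObjLit.lift O, ?_, rfl⟩)
    refine Set.mem_sInter.1 hO {o | ObjLit.lift o ∈ lfpTd (dualProgram P ∅ e) J} ?_
    rintro o ⟨r, hr, hh, hb⟩
    refine lfpTd_closed _ _ ⟨Rule.lift r, Or.inl (Or.inl (Or.inl ⟨r, hr, rfl⟩)), ?_, ?_⟩
    · simp [Rule.lift, hh, Lit.lift]
    · intro L hL
      simp only [Rule.lift, List.mem_map] at hL
      obtain ⟨L, hL, rfl⟩ := hL
      rcases hb L hL with h | ⟨o, rfl, ho⟩
      · exact Or.inl ((hs L).2 h)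
      · exact Or.inr ⟨_, rfl, ho⟩
  · obtain ⟨S, ⟨hS1, hS2⟩, hOS⟩ := Set.mem_sUnion.1 hO
    let B : ObjLit α → Prop := fun O => hasRule P O ∧ ∀ r ∈ P, r.head = Lit.obj O →
          ∃ L ∈ r.body, Lit.sat I (Lit.conjD L) ∨ ∃ o : ObjLit α, L = Lit.obj o ∧ o ∈ S
    have hBfact : ∀ O, B O → ¬ hasFact P O := by
      rintro O ⟨-, h⟩ hf
      obtain ⟨L, hL, -⟩ := h _ hf rfl
      cases hL
    let S' : Set (Lit (DAtom α)) := {L | (∃ O ∈ S, L = Lit.not (ObjLit.lift O)) ∨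
      (∃ O i b, B O ∧ e.enum O i = some b ∧ L = Lit.not (ObjLit.pos (DAtom.foldA O i))) ∨
      (∃ O i b, B O ∧ e.enum O i = some b ∧ L = Lit.not (ObjLit.pos (DAtom.foldB O i)))}
    have key : S' ⊆ Fd (dualProgram P ∅ e) J S' := by
      rintro L (⟨O, hO, rfl⟩ | ⟨O, i, b, hB, hb, rfl⟩ | ⟨O, i, b, hB, hb, rfl⟩)
      · refine ⟨_, rfl, ?_⟩
        rcases hS2 hO with h | h
        · refine ⟨_, Or.inr ⟨ObjLit.lift O, Or.inl (lits_lift (hS1 hO)), rfl⟩, rfl, ?_⟩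
          intro L' hL'
          simp only [List.mem_singleton] at hL'
          subst hL'
          rw [ObjLit.lift_conjE]
          exact Or.inl h
        · by_cases hR : hasRule P O
          · have hB : B O := ⟨hR, h⟩
            refine ⟨_, Or.inl (Or.inl (Or.inr ⟨O, hR, hBfact O hB, Or.inl rfl⟩)), rfl, ?_⟩
            intro L' hL'
            simp only [List.mem_singleton] at hL'
            subst hL'
            obtain ⟨b, hb⟩ := enum_zero e hR
            exact Or.inr (Or.inr (Or.inl ⟨O, 0, b, hB, hb, rfl⟩))
          · refine ⟨_, Or.inl (Or.inr ⟨O, not_mem_lits.2 (hS1 hO), hR, rfl⟩), rfl, ?_⟩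
            intro L' hL'
            simp only [List.mem_singleton] at hL'
            subst hL'
            exact Or.inl trivial
      · refine ⟨_, rfl, ?_⟩
        cases hb' : e.enum O (i + 1) with
        | some b' =>
          refine ⟨_, Or.inl (Or.inl (Or.inr ⟨O, hB.1, hBfact O hB,
            Or.inr (Or.inl ⟨i, b, b', hb, hb', rfl⟩)⟩)), rfl, ?_⟩
          intro L' hL'
          simp only [List.mem_cons, List.not_mem_nil, or_false] at hL'
          rcases hL' with rfl | rfl
          · exact Or.inr (Or.inr (Or.inr ⟨O, i, b, hB, hb, rfl⟩))
          · exact Or.inr (Or.inr (Or.inl ⟨O, i + 1, b', hB, hb', rfl⟩))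
        | none =>
          refine ⟨_, Or.inl (Or.inl (Or.inr ⟨O, hB.1, hBfact O hB,
            Or.inr (Or.inr (Or.inl ⟨i, b, hb, hb', rfl⟩))⟩)), rfl, ?_⟩
          intro L' hL'
          simp only [List.mem_singleton] at hL'
          subst hL'
          exact Or.inr (Or.inr (Or.inr ⟨O, i, b, hB, hb, rfl⟩))
      · refine ⟨_, rfl, ?_⟩
        obtain ⟨L, hL, h⟩ := hB.2 _ ((e.mem_iff O b).2 ⟨i, hb⟩) rfl
        refine ⟨_, Or.inl (Or.inl (Or.inr ⟨O, hB.1, hBfact O hB,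
            Or.inr (Or.inr (Or.inr ⟨i, b, L, hb, hL, rfl⟩))⟩)), rfl, ?_⟩
        intro L' hL'
        simp only [List.mem_singleton] at hL'
        subst hL'
        rcases h with h | ⟨o, rfl, ho⟩
        · exact Or.inl ((hs _).2 h)
        · exact Or.inr (Or.inl ⟨o, ho, rfl⟩)
    exact hJ (Or.inr (subset_gfpFd key (Or.inl ⟨O, hOS, rfl⟩)))

/-- The `j`-th rule for `O` is blocked by `I` and the unfounded set `U`. -/
def Blocked {α : Type} {P : Program α} (e : RuleEnum P) (I : Interp α) (U : Set (ObjLit α))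
    (O : ObjLit α) (j : ℕ) : Prop :=
  ∀ b, e.enum O j = some b →
    ∃ L ∈ b, Lit.sat I (Lit.conjD L) ∨ ∃ o : ObjLit α, L = Lit.obj o ∧ o ∈ U

theorem Blocked.mono {α : Type} {P : Program α} {e : RuleEnum P} {I : Interp α}
    {U : Set (ObjLit α)} {O : ObjLit α} {j : ℕ} (h : Blocked e I ∅ O j) : Blocked e I U O j := by
  intro b hb
  obtain ⟨L, hL, h | ⟨o, -, ho⟩⟩ := h b hb
  · exact ⟨L, hL, Or.inl h⟩
  · exact absurd ho (Set.notMem_empty o)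

/-- The extension of an interpretation to the folding atoms. -/
def extend {α : Type} {P : Program α} (e : RuleEnum P) (I : Interp α) : Interp (DAtom α) :=
  {L | (∃ L₀ ∈ I, L = Lit.lift L₀) ∨
    (∃ O i, (∀ j, i ≤ j → Blocked e I ∅ O j) ∧ L = Lit.not (ObjLit.pos (DAtom.foldA O i))) ∨
    (∃ O i, Blocked e I ∅ O i ∧ L = Lit.not (ObjLit.pos (DAtom.foldB O i)))}

theorem lift_ne_foldA {α : Type} {L : Lit α} {o : ObjLit α} {i : ℕ} :
    Lit.lift L ≠ Lit.not (ObjLit.pos (DAtom.foldA o i)) := by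
  cases L <;> simp [Lit.lift, lift_ne_pos_foldA.symm]

theorem lift_ne_foldB {α : Type} {L : Lit α} {o : ObjLit α} {i : ℕ} :
    Lit.lift L ≠ Lit.not (ObjLit.pos (DAtom.foldB o i)) := by
  cases L <;> simp [Lit.lift, lift_ne_pos_foldB.symm]

theorem mem_extend_lift {α : Type} {P : Program α} (e : RuleEnum P) (I : Interp α) (L : Lit α) :
    Lit.lift L ∈ extend e I ↔ L ∈ I := by
  constructor
  · rintro (⟨L₀, h, hL⟩ | ⟨O, i, -, h⟩ | ⟨O, i, -, h⟩)
    · rw [Lit.lift_inj hL]; exact h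
    · exact absurd h lift_ne_foldA
    · exact absurd h lift_ne_foldB
  · intro h; exact Or.inl ⟨L, h, rfl⟩

theorem mem_extend_foldA {α : Type} {P : Program α} {e : RuleEnum P} {I : Interp α}
    {O : ObjLit α} {i : ℕ} (h : Lit.not (ObjLit.pos (DAtom.foldA O i)) ∈ extend e I) :
    ∀ j, i ≤ j → Blocked e I ∅ O j := by
  rcases h with (⟨L₀, -, hL⟩ | ⟨O, i, h, h'⟩ | ⟨O, i, -, h⟩)
  · exact absurd hL.symm lift_ne_foldA
  · cases h'; exact h
  · cases h

theorem mem_extend_foldB {α : Type} {P : Program α} {e : RuleEnum P} {I : Interp α}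
    {O : ObjLit α} {i : ℕ} (h : Lit.not (ObjLit.pos (DAtom.foldB O i)) ∈ extend e I) :
    Blocked e I ∅ O i := by
  rcases h with (⟨L₀, -, hL⟩ | ⟨O, i, -, h⟩ | ⟨O, i, h, h'⟩)
  · exact absurd hL.symm lift_ne_foldB
  · cases h
  · cases h'; exact h

theorem obj_mem_extend {α : Type} {P : Program α} {e : RuleEnum P} {I : Interp α}
    {X : ObjLit (DAtom α)} (h : Lit.obj X ∈ extend e I) : ∃ O, X = ObjLit.lift O := by
  rcases h with (⟨L₀, -, hL⟩ | ⟨O, i, -, h⟩ | ⟨O, i, -, h⟩)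
  · cases L₀ with
    | obj o => simp only [Lit.lift, Lit.obj.injEq] at hL; exact ⟨o, hL⟩
    | _ => cases hL
  · cases h
  · cases h

/-- Inversion of the rules of the dual program with a negative head. -/
theorem dual_not_inv {α : Type} {P : Program α} (hext : Program.Extended P) {e : RuleEnum P}
    {r : Rule (DAtom α)} (hr : r ∈ dualProgram P ∅ e) {X : ObjLit (DAtom α)}
    (hh : r.head = Lit.not X) :
    (r.body = [Lit.obj X.conjE] ∧ Lit.not X ∈ Program.literals (preDual P e)) ∨
    (∃ O, X = ObjLit.lift O ∧ O ∈ Program.objectiveLiterals P ∧ ¬ hasRule P O) ∨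
    (∃ O, X = ObjLit.lift O ∧ O ∈ Program.objectiveLiterals P ∧
      r.body = [Lit.not (ObjLit.pos (DAtom.foldA O 0))]) ∨
    (∃ O i, X = ObjLit.pos (DAtom.foldA O i) ∧
      r.body = [Lit.not (ObjLit.pos (DAtom.foldB O i)),
        Lit.not (ObjLit.pos (DAtom.foldA O (i + 1)))]) ∨
    (∃ O i, X = ObjLit.pos (DAtom.foldA O i) ∧ e.enum O (i + 1) = none ∧
      r.body = [Lit.not (ObjLit.pos (DAtom.foldB O i))]) ∨
    (∃ O i b L, X = ObjLit.pos (DAtom.foldB O i) ∧ e.enum O i = some b ∧ L ∈ b ∧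
      r.body = [Lit.lift (Lit.conjD L)]) := by
  rcases hr with ((⟨r, hr, rfl⟩ | ⟨o, hR, -, hr⟩) | ⟨o, ho, hn, rfl⟩) | ⟨o, ho, rfl⟩
  · obtain ⟨o, ho⟩ := hext r hr
    simp [Rule.lift, ho, Lit.lift] at hh
  · rcases hr with rfl | ⟨i, b, b', _, _, rfl⟩ | ⟨i, b, _, hn, rfl⟩ | ⟨i, b, L, hb, hL, rfl⟩
    · simp only [Lit.not.injEq] at hh
      exact Or.inr (Or.inr (Or.inl ⟨o, hh.symm, hasRule_mem hR, rfl⟩))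
    · simp only [Lit.not.injEq] at hh
      exact Or.inr (Or.inr (Or.inr (Or.inl ⟨o, i, hh.symm, rfl⟩)))
    · simp only [Lit.not.injEq] at hh
      exact Or.inr (Or.inr (Or.inr (Or.inr (Or.inl ⟨o, i, hh.symm, hn, rfl⟩))))
    · simp only [Lit.not.injEq] at hh
      exact Or.inr (Or.inr (Or.inr (Or.inr (Or.inr ⟨o, i, b, L, hh.symm, hb, hL, rfl⟩))))
  · simp only [Lit.not.injEq] at hh
    exact Or.inr (Or.inl ⟨o, hh.symm, not_mem_lits.1 ho, hn⟩)
  · simp only [Lit.not.injEq] at hh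
    subst hh
    rcases ho with ho | ⟨_, h, _⟩
    · exact Or.inl ⟨rfl, ho⟩
    · exact absurd h (Set.notMem_empty _)

theorem dual_obj_inv {α : Type} {P : Program α} {e : RuleEnum P}
    {r : Rule (DAtom α)} (hr : r ∈ dualProgram P ∅ e) {X : ObjLit (DAtom α)}
    (hh : r.head = Lit.obj X) : ∃ r₀ ∈ P, r = Rule.lift r₀ := by
  rcases hr with ((⟨r, hr, rfl⟩ | ⟨o, hR, -, hr⟩) | ⟨o, ho, hn, rfl⟩) | ⟨o, ho, rfl⟩
  · exact ⟨r, hr, rfl⟩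
  · rcases hr with rfl | ⟨i, b, b', _, _, rfl⟩ | ⟨i, b, _, hn, rfl⟩ | ⟨i, b, L, hb, hL, rfl⟩ <;>
      cases hh
  · cases hh
  · cases hh

/-- The extension of a prefixed point to the folding atoms is a prefixed point. -/
theorem backward {α : Type} (P : Program α) (hext : Program.Extended P) (e : RuleEnum P)
    (I : Interp α) (hI : omegaExt P I ⊆ I) :
    omegaD (dualProgram P ∅ e) (extend e I) ⊆ extend e I := by
  have hs := sat_lift I (extend e I) (mem_extend_lift e I)
  rintro L (⟨X, hX, rfl⟩ | hX)
  · have : X ∈ ObjLit.lift '' lfpTx P I := by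
      refine Set.mem_sInter.1 hX (ObjLit.lift '' lfpTx P I) ?_
      rintro X ⟨r, hr, hh, hb⟩
      obtain ⟨r, hrP, rfl⟩ := dual_obj_inv hr hh
      obtain ⟨O, hO⟩ := hext r hrP
      simp only [Rule.lift, hO, Lit.lift, Lit.obj.injEq] at hh
      refine ⟨O, lfpTx_closed P I ⟨r, hrP, hO, fun L hL => ?_⟩, hh⟩
      rcases hb (Lit.lift L) (List.mem_map_of_mem hL) with h | ⟨o, h, o', ho', rfl⟩
      · exact Or.inl ((hs L).1 h)
      · refine Or.inr ⟨o', Lit.lift_inj h, ho'⟩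
    obtain ⟨O, hO, rfl⟩ := this
    exact (mem_extend_lift e I (.obj O)).2 (hI (Or.inl ⟨O, hO, rfl⟩))
  · obtain ⟨S, ⟨-, hS⟩, hLS⟩ := Set.mem_sUnion.1 hX
    let U : Set (ObjLit α) := {O | Lit.not (ObjLit.lift O) ∈ S}
    have hB : ∀ O i, (Lit.not (ObjLit.pos (DAtom.foldB O i)) ∈ extend e I ∨
        Lit.not (ObjLit.pos (DAtom.foldB O i)) ∈ S) → Blocked e I U O i := by
      rintro O i (h | h)
      · exact (mem_extend_foldB h).mono
      · obtain ⟨X, hX, r, hr, hh, hb⟩ := hS h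
        cases hX
        rcases dual_not_inv hext hr hh with ⟨h1, -⟩ | ⟨_, h1, -⟩ | ⟨_, h1, -⟩ | ⟨_, _, h1, -⟩ |
          ⟨_, _, h1, -⟩ | ⟨O', i', b, L, h1, h2, h3, h4⟩
        · have := hb (Lit.obj (ObjLit.neg (DAtom.foldB O i))) (by rw [h1]; exact List.mem_singleton.2 rfl)
          rcases this with h | h
          · obtain ⟨o, ho⟩ := obj_mem_extend h
            cases o <;> cases ho
          · obtain ⟨_, h, -⟩ := hS h
            cases h
        · exact absurd h1 lift_ne_pos_foldB
        · exact absurd h1 lift_ne_pos_foldB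
        · cases h1
        · cases h1
        · cases h1
          intro b' hb'
          rw [h2] at hb'
          cases hb'
          refine ⟨L, h3, ?_⟩
          rcases hb (Lit.lift (Lit.conjD L)) (by rw [h4]; exact List.mem_singleton.2 rfl) with h | h
          · exact Or.inl ((hs _).1 h)
          · right
            obtain ⟨o, ho, -⟩ := hS h
            cases L with
            | obj o => exact ⟨o, rfl, h⟩
            | _ => cases ho
    have hA1 : ∀ O i, (Lit.not (ObjLit.pos (DAtom.foldA O i)) ∈ S) →
        Blocked e I U O i ∧ ((∀ j, i + 1 ≤ j → Blocked e I U O j) ∨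
          Lit.not (ObjLit.pos (DAtom.foldA O (i + 1))) ∈ S) := by
      intro O i h
      obtain ⟨X, hX, r, hr, hh, hb⟩ := hS h
      cases hX
      rcases dual_not_inv hext hr hh with ⟨h1, -⟩ | ⟨_, h1, -⟩ | ⟨_, h1, -⟩ | ⟨_, _, h1, h2⟩ |
          ⟨_, _, h1, h2, h3⟩ | ⟨O', i', b, L, h1, h2, h3, h4⟩
      · have := hb (Lit.obj (ObjLit.neg (DAtom.foldA O i))) (by rw [h1]; exact List.mem_singleton.2 rfl)
        rcases this with h | h
        · obtain ⟨o, ho⟩ := obj_mem_extend h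
          cases o <;> cases ho
        · obtain ⟨_, h, -⟩ := hS h
          cases h
      · exact absurd h1 lift_ne_pos_foldA
      · exact absurd h1 lift_ne_pos_foldA
      · cases h1
        rw [h2] at hb
        refine ⟨hB O i (hb (Lit.not (ObjLit.pos (DAtom.foldB O i))) (by simp)), ?_⟩
        rcases hb (Lit.not (ObjLit.pos (DAtom.foldA O (i + 1)))) (by simp) with h | h
        · exact Or.inl fun j hj => (mem_extend_foldA h j hj).mono
        · exact Or.inr h
      · cases h1
        rw [h3] at hb
        refine ⟨hB O i (hb (Lit.not (ObjLit.pos (DAtom.foldB O i))) (by simp)), Or.inl fun j hj b hb => ?_⟩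
        rw [enum_none_ge e h2 hj] at hb
        cases hb
      · cases h1
    have hA : ∀ O i, (Lit.not (ObjLit.pos (DAtom.foldA O i)) ∈ S) →
        ∀ j, i ≤ j → Blocked e I U O j := by
      intro O i h j hj
      obtain ⟨n, rfl⟩ := Nat.exists_eq_add_of_le hj
      clear hj
      induction n generalizing i with
      | zero => exact (hA1 O i h).1
      | succ k ih =>
        rcases (hA1 O i h).2 with h' | h'
        · exact h' _ (by omega)
        · have := ih (i + 1) h'
          rwa [show i + 1 + k = i + (k + 1) by omega] at this
    have hU : U ⊆ Program.objectiveLiterals P ∧ U ⊆ Fx P I U := by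
      have : ∀ O ∈ U, O ∈ Program.objectiveLiterals P ∧ O ∈ Fx P I U := by
        intro O hO
        obtain ⟨X, hX, r, hr, hh, hb⟩ := hS hO
        cases hX
        rcases dual_not_inv hext hr hh with ⟨h1, h2⟩ | ⟨O', h1, h2, h3⟩ | ⟨O', h1, h2, h3⟩ |
          ⟨_, _, h1, h2⟩ | ⟨_, _, h1, h2, h3⟩ | ⟨O', i', b, L, h1, h2, h3, h4⟩
        · refine ⟨lits_preDual h2, Or.inl ?_⟩
          rcases hb (Lit.obj (ObjLit.lift O).conjE) (by rw [h1]; exact List.mem_singleton.2 rfl)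
            with h | h
          · rw [ObjLit.lift_conjE] at h
            exact (hs (.obj O.conjE)).1 h
          · obtain ⟨_, h, -⟩ := hS h
            cases h
        · cases ObjLit.lift_inj h1
          refine ⟨h2, Or.inr fun r hr hh => ?_⟩
          exact absurd ⟨r.body, by rw [← hh]; exact hr⟩ h3
        · cases ObjLit.lift_inj h1
          refine ⟨h2, Or.inr fun r hr hh => ?_⟩
          have hbl : ∀ j, 0 ≤ j → Blocked e I U O j := by
            rcases hb (Lit.not (ObjLit.pos (DAtom.foldA O 0)))
              (by rw [h3]; exact List.mem_singleton.2 rfl) with h | h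
            · exact fun j hj => (mem_extend_foldA h j hj).mono
            · exact hA O 0 h
          obtain ⟨i, hi⟩ := (e.mem_iff O r.body).1 (by rw [← hh]; exact hr)
          exact hbl i (Nat.zero_le i) _ hi
        · exact absurd h1.symm lift_ne_pos_foldA
        · exact absurd h1.symm lift_ne_pos_foldA
        · exact absurd h1.symm lift_ne_pos_foldB
      exact ⟨fun O hO => (this O hO).1, fun O hO => (this O hO).2⟩
    have hUI : ∀ O ∈ U, Lit.not O ∈ I := fun O hO =>
      hI (Or.inr ⟨O, Set.mem_sUnion.2 ⟨U, hU, hO⟩, rfl⟩)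
    have hBU : ∀ O i, Blocked e I U O i → Blocked e I ∅ O i := by
      intro O i h b hb
      obtain ⟨L, hL, h | ⟨o, rfl, ho⟩⟩ := h b hb
      · exact ⟨L, hL, Or.inl h⟩
      · exact ⟨_, hL, Or.inl (hUI o ho)⟩
    have hLS' := hLS
    obtain ⟨X, rfl, r, hr, hh, hb⟩ := hS hLS
    rcases X with (a | ⟨O, i⟩ | ⟨O, i⟩) | (a | ⟨O, i⟩ | ⟨O, i⟩)
    · exact (mem_extend_lift e I (.not (.pos a))).2 (hUI (.pos a) hLS')
    · exact Or.inr (Or.inl ⟨O, i, fun j hj => hBU O j (hA O i hLS' j hj), rfl⟩)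
    · exact Or.inr (Or.inr ⟨O, i, hBU O i (hB O i (Or.inr hLS')), rfl⟩)
    · exact (mem_extend_lift e I (.not (.neg a))).2 (hUI (.neg a) hLS')
    all_goals
      exfalso
      rcases dual_not_inv hext hr hh with ⟨h1, -⟩ | ⟨o, h1, -⟩ | ⟨o, h1, -⟩ | ⟨_, _, h1, -⟩ |
          ⟨_, _, h1, -⟩ | ⟨_, _, _, _, h1, -⟩
      · rcases hb _ (by rw [h1]; exact List.mem_singleton.2 rfl) with h | h
        · obtain ⟨o, ho⟩ := obj_mem_extend h
          cases o <;> cases ho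
        · obtain ⟨_, h, -⟩ := hS h
          cases h
      · cases o <;> cases h1
      · cases o <;> cases h1
      · cases h1
      · cases h1
      · cases h1

/-- For a ground program `P` with an empty set of abducibles, for
every literal `L ∈ literals(P)`: `L ∈ WFS(P)` iff `L ∈ lfp(ω_d^{dual(P,∅)})`,
where the least fixed point is taken in the information ordering. -/
theorem dual_transformation_correct {α : Type} (P : Program α) (hcnt : P.Countable)
    (hext : Program.Extended P) (e : RuleEnum P) :
    ∀ L ∈ Program.literals P,
      (L ∈ WFS P ↔ Lit.lift L ∈ lfpOmegaD (dualProgram P (∅ : Set (ObjLit α)) e)) := by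
  intro L _
  constructor
  · intro h
    refine Set.mem_sInter.2 fun J hJ => ?_
    exact Set.mem_sInter.1 h {L | Lit.lift L ∈ J} (forward P e J hJ)
  · intro h
    refine Set.mem_sInter.2 fun I hI => ?_
    exact (mem_extend_lift e I L).1 (Set.mem_sInter.1 h _ (backward P hext e I hI))
end Abdual
end
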